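/- Let I₁, I₂ ⊆ ℕ with I₁ ⊄ I₂. Then (1) ML_A⁺(I₁) is exponentially more succinct than ML_A⁺(I₂), and (2) there is an ML_A(I₁)-formula for which there is no equivalent ML_A(I₂)-formula. -/

import Mathlib

set_option autoImplicit false
attribute [local instance] Classical.propDecidable

/-- A Kripke model with `n` modalities: a nonempty set of worlds, `n` accessibility
relations, and a propositional assignment (variables are indexed by `ℕ`). -/
structure KripkeModel (n : ℕ) : Type 1 where
  W : Type
  nonempty : Nonempty W
  R : Fin n → W → W → Prop
  val : ℕ → Set W

/-- A pointed Kripke model. -/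
structure PointedModel (n : ℕ) : Type 1 where
  M : KripkeModel n
  w : M.W

/-- Successor selection functions of arity `n`. -/
def SSF (n : ℕ) : Type 1 :=
  (M : KripkeModel n) → M.W → Set M.W

/-- Formulas of the modal logic `ML⁺(𝒪)` for a set `𝒪` of successor selection functions. -/
inductive MLFormula {n : ℕ} (Os : Set (SSF n)) : Type 1 where
  | var : ℕ → MLFormula Os
  | neg : MLFormula Os → MLFormula Os
  | or : MLFormula Os → MLFormula Os → MLFormula Os
  | box : Os → MLFormula Os → MLFormula Os

/-- Size of a formula: number of nodes of its syntax tree. -/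
def MLFormula.size {n : ℕ} {Os : Set (SSF n)} : MLFormula Os → ℕ
  | .var _ => 1
  | .neg φ => φ.size + 1
  | .or φ ψ => φ.size + ψ.size + 1
  | .box _ φ => φ.size + 1

/-- Satisfaction of an `ML⁺(𝒪)` formula in a pointed model. -/
def Satisfies {n : ℕ} {Os : Set (SSF n)} (M : KripkeModel n) : M.W → MLFormula Os → Prop
  | w, .var p => w ∈ M.val p
  | w, .neg φ => ¬ Satisfies M w φ
  | w, .or φ ψ => Satisfies M w φ ∨ Satisfies M w ψ
  | w, .box O φ => ∀ w' ∈ O.val M w, Satisfies M w' φ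

/-- Two formulas (of possibly different logics) are equivalent if they are satisfied
by exactly the same pointed models. -/
def FEquiv {n : ℕ} {Os₁ Os₂ : Set (SSF n)} (φ : MLFormula Os₁) (ψ : MLFormula Os₂) : Prop :=
  ∀ (M : KripkeModel n) (w : M.W), Satisfies M w φ ↔ Satisfies M w ψ

/-- `ML⁺(𝒪₂)` is at least as expressive as `ML⁺(𝒪₁)`. -/
def LeExpr {n : ℕ} (Os₁ Os₂ : Set (SSF n)) : Prop :=
  ∀ φ : MLFormula Os₁, ∃ ψ : MLFormula Os₂, FEquiv φ ψ

/-- `ML⁺(𝒪₂)` is at least as succinct as `ML⁺(𝒪₁)`: there is a fixed polynomial `p` such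
that every `ML⁺(𝒪₁)`-formula has an equivalent `ML⁺(𝒪₂)`-formula of polynomially bounded size. -/
def LePoly {n : ℕ} (Os₁ Os₂ : Set (SSF n)) : Prop :=
  ∃ p : Polynomial ℕ, ∀ φ : MLFormula Os₁, ∃ ψ : MLFormula Os₂,
    FEquiv φ ψ ∧ ψ.size ≤ p.eval φ.size

def EquallyExpressive {n : ℕ} (Os₁ Os₂ : Set (SSF n)) : Prop :=
  LeExpr Os₁ Os₂ ∧ LeExpr Os₂ Os₁

/-- `ML⁺(𝒪₁)` is exponentially more succinct than `ML⁺(𝒪₂)`: there is a sequence of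
`ML⁺(𝒪₁)`-formulas of linearly bounded size and some `c > 1` such that every equivalent
`ML⁺(𝒪₂)`-formula of the `i`-th formula has size at least `c ^ i`. -/
def ExpMoreSuccinct {n : ℕ} (Os₁ Os₂ : Set (SSF n)) : Prop :=
  ∃ (φ : ℕ → MLFormula Os₁) (a b : ℕ) (c : ℝ), 1 < c ∧
    (∀ i : ℕ, (φ i).size ≤ a * i + b) ∧
    ∀ (i : ℕ) (ψ : MLFormula Os₂), FEquiv (φ i) ψ → c ^ i ≤ ((ψ.size : ℕ) : ℝ)

/-- The successor selection function given by an `n`-ary Boolean function `f`: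
it selects the `f`-successors. -/
noncomputable def OfBool {n : ℕ} (f : (Fin n → Bool) → Bool) : SSF n :=
  fun M w => {w' | f (fun j => decide (M.R j w w')) = true}

/-- The set of successor selection functions given by a set of `n`-ary Boolean functions. -/
def boolSSFs {n : ℕ} (F : Set ((Fin n → Bool) → Bool)) : Set (SSF n) :=
  OfBool '' F

/-- `sSucc M s w w'` : `w'` is an `s`-successor of `w` in `M`. -/
def sSucc {n : ℕ} (M : KripkeModel n) : List (Fin n) → M.W → M.W → Prop
  | [], w, w' => w' = w
  | a :: s, w, w' => ∃ u, M.R a w u ∧ sSucc M s u w'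

/-- The successor selection function given by a language `L`: it selects all
`s`-successors for words `s ∈ L`. -/
def OfLang {n : ℕ} (L : Set (List (Fin n))) : SSF n :=
  fun M w => {w' | ∃ s ∈ L, sSucc M s w w'}

/-- The set of successor selection functions given by a set of languages. -/
def langSSFs {n : ℕ} (Ls : Set (Set (List (Fin n)))) : Set (SSF n) :=
  OfLang '' Ls

/-- The operators of standard multimodal logic `ML_n`: the singleton one-letter languages. -/
def MLn_ops (n : ℕ) : Set (SSF n) := {O | ∃ j : Fin n, O = OfLang {[j]}}

/-- `nestBoxes s φ` is the formula `□_{s₁}□_{s₂}…□_{s_k} φ`. -/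
def nestBoxes {n : ℕ} : List (Fin n) → MLFormula (MLn_ops n) → MLFormula (MLn_ops n)
  | [], φ => φ
  | j :: s, φ => .box ⟨OfLang {[j]}, ⟨j, rfl⟩⟩ (nestBoxes s φ)

/-! ### Alternation languages (alphabet {1,2} represented as `Fin 2`, letter `0` ↦ 1, `1` ↦ 2) -/

/-- The (0-based) `j`-th letter of the alternating word starting with letter `b`. -/
def altLetter (b : Fin 2) (j : ℕ) : Fin 2 := if j % 2 = 0 then b else b + 1

/-- The alternating word of length `ℓ` starting with letter `b`. -/
def altWord (b : Fin 2) (ℓ : ℕ) : List (Fin 2) := (List.range ℓ).map (altLetter b)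

/-- The alternation language `A_ℓ` of length `ℓ`. -/
def altLang (ℓ : ℕ) : Set (List (Fin 2)) := {altWord 0 ℓ, altWord 1 ℓ}

/-- Operators of the logic `ML_A(I)`. -/
def MLA_ops (I : Set ℕ) : Set (SSF 2) := (fun ℓ => OfLang (altLang ℓ)) '' I

/-- Operators of the logic `ML_A⁺(I)` (alternation operators plus the classical boxes). -/
def MLAp_ops (I : Set ℕ) : Set (SSF 2) :=
  MLA_ops I ∪ {OfLang {[(0 : Fin 2)]}, OfLang {[(1 : Fin 2)]}}

/-- The formula `[A_ℓ]^i p` (where `p` is the fixed propositional variable `0`),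
as a formula of `ML_A({ℓ})`. -/
def boxAltIter (ℓ : ℕ) : ℕ → MLFormula (MLA_ops {ℓ})
  | 0 => .var 0
  | i + 1 => .box ⟨OfLang (altLang ℓ), ⟨ℓ, rfl, rfl⟩⟩ (boxAltIter ℓ i)

/-! ### Formula size games -/

/-- The class `{(M,w') | (M,w) ∈ C, w' ∈ O(M,w)}` used in the box move. -/
def boxImage {n : ℕ} (O : SSF n) (C : Set (PointedModel n)) : Set (PointedModel n) :=
  {q | ∃ m ∈ C, ∃ w' ∈ O m.M m.w, q = ⟨m.M, w'⟩}

/-- Closed game trees of the formula size game `FSG(𝒪)`, with root label `⟨C∘D⟩`.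
Each constructor corresponds to a legal Spoiler move; leaves are atomic moves. -/
inductive GameTree {n : ℕ} (Os : Set (SSF n)) :
    Set (PointedModel n) → Set (PointedModel n) → Type 1 where
  | atom (p : ℕ) (C D : Set (PointedModel n))
      (hC : ∀ q ∈ C, q.w ∈ q.M.val p) (hD : ∀ q ∈ D, q.w ∉ q.M.val p) :
      GameTree Os C D
  | not (C D : Set (PointedModel n)) (t : GameTree Os D C) : GameTree Os C D
  | or (C₁ C₂ D : Set (PointedModel n))
      (t₁ : GameTree Os C₁ D) (t₂ : GameTree Os C₂ D) : GameTree Os (C₁ ∪ C₂) D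
  | box (O : SSF n) (hO : O ∈ Os) (C D D₁ : Set (PointedModel n))
      (hD : ∀ q ∈ D, ∃ w' ∈ O q.M q.w, (⟨q.M, w'⟩ : PointedModel n) ∈ D₁)
      (t : GameTree Os (boxImage O C) D₁) : GameTree Os C D

/-- Number of nodes of a game tree. -/
def gameTreeSize {n : ℕ} {Os : Set (SSF n)} :
    ∀ (C D : Set (PointedModel n)), GameTree Os C D → ℕ
  | _, _, .atom _ _ _ _ _ => 1
  | _, _, .not _ _ t => gameTreeSize _ _ t + 1
  | _, _, .or _ _ _ t₁ t₂ => gameTreeSize _ _ t₁ + gameTreeSize _ _ t₂ + 1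
  | _, _, .box _ _ _ _ _ _ t => gameTreeSize _ _ t + 1

/-- `IsSubtree t T bl par` : the root of `t` is a node of `T`; `bl` is the sequence of
successor selection functions labelling box moves on the path from `T`'s root to this node
(excluding the node's own label), and `par = true` iff the path contains an even number
of `¬`-labels. -/
inductive IsSubtree {n : ℕ} {Os : Set (SSF n)} :
    ∀ {C D A B : Set (PointedModel n)},
      GameTree Os C D → GameTree Os A B → List (SSF n) → Bool → Prop where
  | refl {A B : Set (PointedModel n)} (t : GameTree Os A B) : IsSubtree t t [] true
  | not {C D A B : Set (PointedModel n)} {bl : List (SSF n)} {par : Bool}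
      {t : GameTree Os C D} {t' : GameTree Os B A} :
      IsSubtree t t' bl par → IsSubtree t (.not A B t') bl (!par)
  | orLeft {C D A₁ A₂ B : Set (PointedModel n)} {bl : List (SSF n)} {par : Bool}
      {t : GameTree Os C D} {t₁ : GameTree Os A₁ B} (t₂ : GameTree Os A₂ B) :
      IsSubtree t t₁ bl par → IsSubtree t (.or A₁ A₂ B t₁ t₂) bl par
  | orRight {C D A₁ A₂ B : Set (PointedModel n)} {bl : List (SSF n)} {par : Bool}
      {t : GameTree Os C D} (t₁ : GameTree Os A₁ B) {t₂ : GameTree Os A₂ B} :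
      IsSubtree t t₂ bl par → IsSubtree t (.or A₁ A₂ B t₁ t₂) bl par
  | box {C D A B D₁ : Set (PointedModel n)} {bl : List (SSF n)} {par : Bool}
      {t : GameTree Os C D} (O : SSF n) (hO : O ∈ Os)
      (hD : ∀ q ∈ B, ∃ w' ∈ O q.M q.w, (⟨q.M, w'⟩ : PointedModel n) ∈ D₁)
      {t' : GameTree Os (boxImage O A) D₁} :
      IsSubtree t t' bl par → IsSubtree t (.box O hO A B D₁ hD t') (O :: bl) par

/-! ### The canonical game tree `T^ψ` corresponding to a formula `ψ` -/

/-- Positions (nodes) in the syntax tree of a formula. -/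
inductive FPos {n : ℕ} {Os : Set (SSF n)} : MLFormula Os → Type 1 where
  | root (φ : MLFormula Os) : FPos φ
  | negChild {φ : MLFormula Os} : FPos φ → FPos (.neg φ)
  | orLeft {φ ψ : MLFormula Os} : FPos φ → FPos (.or φ ψ)
  | orRight {φ ψ : MLFormula Os} : FPos ψ → FPos (.or φ ψ)
  | boxChild {O : Os} {φ : MLFormula Os} : FPos φ → FPos (.box O φ)

/-- `nodeData φ v C D` computes, for the node `v` of the closed game tree `T^φ(⟨C∘D⟩)`
obtained by playing the Spoiler strategy corresponding to `φ` on the starting node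
`⟨C∘D⟩`, the tuple (left label class, right label class, boxlabels, parity of ¬'s). -/
def nodeData {n : ℕ} {Os : Set (SSF n)} :
    (φ : MLFormula Os) → FPos φ →
      Set (PointedModel n) → Set (PointedModel n) →
      Set (PointedModel n) × Set (PointedModel n) × List (SSF n) × Bool
  | _, .root _, C, D => (C, D, [], true)
  | .neg φ, .negChild q, C, D =>
      let r := nodeData φ q D C
      (r.1, r.2.1, r.2.2.1, !r.2.2.2)
  | .or φ₁ _, .orLeft q, C, D =>
      nodeData φ₁ q {m ∈ C | Satisfies m.M m.w φ₁} D
  | .or _ φ₂, .orRight q, C, D =>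
      nodeData φ₂ q {m ∈ C | Satisfies m.M m.w φ₂} D
  | .box O φ, .boxChild q, C, D =>
      let r := nodeData φ q (boxImage O.val C)
        {m ∈ boxImage O.val D | ¬ Satisfies m.M m.w φ}
      (r.1, r.2.1, O.val :: r.2.2.1, r.2.2.2)

/-- A position is a leaf of the game tree iff the corresponding subformula is a variable. -/
def isLeafPos {n : ℕ} {Os : Set (SSF n)} : (φ : MLFormula Os) → FPos φ → Prop
  | .var _, .root _ => True
  | .neg _, .root _ => False
  | .or _ _, .root _ => False
  | .box _ _, .root _ => False
  | .neg φ, .negChild q => isLeafPos φ q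
  | .or φ _, .orLeft q => isLeafPos φ q
  | .or _ ψ, .orRight q => isLeafPos ψ q
  | .box _ φ, .boxChild q => isLeafPos φ q

/-! ### The models `A*_{ℓ,i}` and `B*_{ℓ,s}` -/

/-- Extend a string `s ∈ {1,2}^i` to an infinite string (only the first `i` letters matter). -/
def extendStr {i : ℕ} (s : Fin i → Fin 2) : ℕ → Fin 2 :=
  fun d => if h : d < i then s ⟨d, h⟩ else 0

/-- The (0-based) `d`-th letter of the concatenation `a_ℓ^{s 0} a_ℓ^{s 1} …`. -/
def bLetter (ℓ : ℕ) (s : ℕ → Fin 2) (d : ℕ) : Fin 2 :=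
  altLetter (s (d / ℓ)) (d % ℓ)

/-- The extended model `B*_{ℓ,s}`: a path of length `i·ℓ` spelling `a^ℓ_s`, a trap world
(`none`) with a 1-loop and a 2-loop where `p` (variable 0) is true, and `j`-edges to the
trap from every base world lacking a `j`-successor. -/
def Bstar (ℓ i : ℕ) (s : ℕ → Fin 2) : KripkeModel 2 where
  W := Option (Fin (i * ℓ + 1))
  nonempty := ⟨none⟩
  R := fun j x y =>
    match x, y with
    | none, none => True
    | none, some _ => False
    | some d, some d' => (d' : ℕ) = (d : ℕ) + 1 ∧ bLetter ℓ s (d : ℕ) = j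
    | some d, none => ¬ (((d : ℕ) < i * ℓ) ∧ bLetter ℓ s (d : ℕ) = j)
  val := fun p => {x | p = 0 ∧ x = none}

/-- The root `w₀^B` of `B*_{ℓ,s}`. -/
def rootB (ℓ i : ℕ) (s : ℕ → Fin 2) : (Bstar ℓ i s).W :=
  some ⟨0, Nat.succ_pos _⟩

/-- Base worlds of `A*_{ℓ,i}`: a depth `d ≤ i·ℓ` together with the branch (which of the
two alternating words the current segment follows); the branch is normalized to `0` at
the main worlds (depths that are multiples of `ℓ`). -/
def AstarBase (ℓ i : ℕ) : Type :=
  {x : ℕ × Fin 2 // x.1 ≤ i * ℓ ∧ (x.1 % ℓ = 0 → x.2 = 0)}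

/-- Edges of the base model `A-base_{ℓ,i}` with label `j`. -/
def AbaseEdge (ℓ : ℕ) (j : Fin 2) (x y : ℕ × Fin 2) : Prop :=
  y.1 = x.1 + 1 ∧ ∃ c : Fin 2, j = altLetter c (x.1 % ℓ) ∧
    (x.1 % ℓ ≠ 0 → c = x.2) ∧ (y.1 % ℓ ≠ 0 → c = y.2)

/-- The extended model `A*_{ℓ,i}`: between consecutive main worlds there are two disjoint
paths spelling `a_ℓ^1` and `a_ℓ^2`; a trap world (`none`) with a 1-loop and a 2-loop where
`p` is false; `j`-edges to the trap from every base world lacking a `j`-successor.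
The variable `p` (variable 0) is true exactly at the final main world `w_i`. -/
def Astar (ℓ i : ℕ) : KripkeModel 2 where
  W := Option (AstarBase ℓ i)
  nonempty := ⟨none⟩
  R := fun j x y =>
    match x, y with
    | none, none => True
    | none, some _ => False
    | some a, some b => AbaseEdge ℓ j a.val b.val
    | some a, none => ¬ ∃ b : AstarBase ℓ i, AbaseEdge ℓ j a.val b.val
  val := fun p => {x | p = 0 ∧ x = some ⟨(i * ℓ, 0), le_refl _, fun _ => rfl⟩}

/-- The root `w₀^A` of `A*_{ℓ,i}`. -/
def rootA (ℓ i : ℕ) : (Astar ℓ i).W :=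
  some ⟨(0, 0), Nat.zero_le _, fun _ => rfl⟩

/-- The class `𝔸_{ℓ,i}`. -/
def classA (ℓ i : ℕ) : Set (PointedModel 2) :=
  {⟨Astar ℓ i, rootA ℓ i⟩}

/-- The class `𝔹_{ℓ,i}`. -/
def classB (ℓ i : ℕ) : Set (PointedModel 2) :=
  {q | ∃ s : Fin i → Fin 2, q = ⟨Bstar ℓ i (extendStr s), rootB ℓ i (extendStr s)⟩}

/-- A node with label classes `C`, `D` covers the string `s` if one of the classes
contains a pointed model `(B*_{ℓ,s}, w)`. -/
def Covers (ℓ i : ℕ) (C D : Set (PointedModel 2)) (s : Fin i → Fin 2) : Prop :=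
  ∃ w : (Bstar ℓ i (extendStr s)).W,
    (⟨Bstar ℓ i (extendStr s), w⟩ : PointedModel 2) ∈ C ∪ D

/-- The word `a^ℓ_s = a_ℓ^{s₁} a_ℓ^{s₂} … a_ℓ^{s_i}`. -/
def aWord (ℓ : ℕ) {i : ℕ} (s : Fin i → Fin 2) : List (Fin 2) :=
  (List.ofFn fun j => altWord (s j) ℓ).flatten

/-- A language is length-uniform if it is nonempty and all its words have the same length. -/
def LengthUniform (L : Set (List (Fin 2))) : Prop :=
  L.Nonempty ∧ ∃ d : ℕ, ∀ x ∈ L, x.length = d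

/-- `‖L‖`: the common word length of a length-uniform language. -/
noncomputable def luLen (L : Set (List (Fin 2))) : ℕ :=
  sInf {d : ℕ | ∃ x ∈ L, x.length = d}

/-- Concatenation of languages. -/
def langConcat (L₁ L₂ : Set (List (Fin 2))) : Set (List (Fin 2)) :=
  {x | ∃ a ∈ L₁, ∃ b ∈ L₂, x = a ++ b}

/-- `L₁ ∘ L₂ ∘ … ∘ L_m` for a list of languages. -/
def concatList (Ls : List (Set (List (Fin 2)))) : Set (List (Fin 2)) :=
  Ls.foldr langConcat {([] : List (Fin 2))}

/-- `𝒪`-bisimulations. -/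
def IsOBisim {n : ℕ} (Os : Set (SSF n)) (M₁ M₂ : KripkeModel n)
    (Z : M₁.W → M₂.W → Prop) : Prop :=
  ∀ w₁ w₂, Z w₁ w₂ →
    (∀ p : ℕ, w₁ ∈ M₁.val p ↔ w₂ ∈ M₂.val p) ∧
    (∀ O ∈ Os, ∀ w₁' ∈ O M₁ w₁, ∃ w₂' ∈ O M₂ w₂, Z w₁' w₂') ∧
    (∀ O ∈ Os, ∀ w₂' ∈ O M₂ w₂, ∃ w₁' ∈ O M₁ w₁, Z w₁' w₂')

/-! ### Alternating words -/

theorem fin2_add_one_add_one (b : Fin 2) : b + 1 + 1 = b := by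
  revert b; decide

theorem fin2_eq_of_ne {a b c : Fin 2} (h₁ : a ≠ c) (h₂ : b ≠ c) : a = b := by
  revert a b c; decide

theorem fin2_eq_or (a b : Fin 2) : a = b ∨ a = b + 1 := by
  revert a b; decide

theorem fin2_ne_add_one (b : Fin 2) : b ≠ b + 1 := by
  revert b; decide

theorem altLetter_zero (b : Fin 2) : altLetter b 0 = b := by
  simp [altLetter]

theorem altLetter_succ (b : Fin 2) (j : ℕ) : altLetter b (j + 1) = altLetter (b + 1) j := by
  unfold altLetter
  rcases Nat.mod_two_eq_zero_or_one j with h | h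
  · have h' : (j + 1) % 2 = 1 := by omega
    simp [h, h']
  · have h' : (j + 1) % 2 = 0 := by omega
    simp [h, h', fin2_add_one_add_one]

theorem altLetter_succ' (b : Fin 2) (j : ℕ) : altLetter b (j + 1) = altLetter b j + 1 := by
  unfold altLetter
  rcases Nat.mod_two_eq_zero_or_one j with h | h
  · have h' : (j + 1) % 2 = 1 := by omega
    simp [h, h']
  · have h' : (j + 1) % 2 = 0 := by omega
    simp [h, h', fin2_add_one_add_one]

theorem altWord_zero (b : Fin 2) : altWord b 0 = [] := rfl

theorem altWord_succ (b : Fin 2) (m : ℕ) : altWord b (m + 1) = b :: altWord (b + 1) m := by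
  unfold altWord
  rw [List.range_succ_eq_map]
  simp only [List.map_cons, List.map_map, altLetter_zero]
  congr 1
  apply List.map_congr_left
  intro j _
  exact altLetter_succ b j

theorem length_altWord (b : Fin 2) (m : ℕ) : (altWord b m).length = m := by
  simp [altWord]

theorem mem_altLang {m : ℕ} {w : List (Fin 2)} : w ∈ altLang m ↔ ∃ b, w = altWord b m := by
  constructor
  · rintro (rfl | rfl)
    exacts [⟨0, rfl⟩, ⟨1, rfl⟩]
  · rintro ⟨b, rfl⟩
    fin_cases b
    exacts [Or.inl rfl, Or.inr rfl]

theorem bLetter_mul {ℓ : ℕ} (hℓ : 1 ≤ ℓ) (s : ℕ → Fin 2) (j : ℕ) :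
    bLetter ℓ s (j * ℓ) = s j := by
  unfold bLetter
  rw [Nat.mul_mod_left, Nat.mul_div_cancel _ hℓ, altLetter_zero]

theorem bLetter_mul_add {ℓ : ℕ} (s : ℕ → Fin 2) (j : ℕ) {r : ℕ} (hr : r < ℓ) :
    bLetter ℓ s (j * ℓ + r) = altLetter (s j) r := by
  unfold bLetter
  rw [Nat.mul_add_mod_of_lt hr, Nat.mul_comm, Nat.mul_add_div (by omega),
    Nat.div_eq_of_lt hr, Nat.add_zero]

/-! ### The separating models -/

/-- Transition function of the separating model. A world `some (b, d)` has read `d` letters of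
the word spelled by `s`; a wrong letter at a block boundary leads to `none`, and a wrong letter
inside of a block forgets `b` and resets it to a value depending only on the block. -/
noncomputable def resetStep (ℓ n : ℕ) (s : ℕ → Fin 2) (τ : ℕ → Bool) :
    Option (Bool × ℕ) → Fin 2 → Option (Bool × ℕ)
  | none, _ => none
  | some (b, d), j =>
    if n ≤ d then none
    else if bLetter ℓ s d = j then some (b, d + 1)
    else if d % ℓ = 0 then none
    else some (τ (d / ℓ), d + 1)

/-- The deterministic model with transition function `resetStep`; every variable is false
exactly at `some (false, n)`. -/
noncomputable def resetModel (ℓ n : ℕ) (s : ℕ → Fin 2) (τ : ℕ → Bool) : KripkeModel 2 where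
  W := Option (Bool × ℕ)
  nonempty := ⟨none⟩
  R := fun j x y => y = resetStep ℓ n s τ x j
  val := fun _ => {x | x ≠ some (false, n)}

/-- The world reached in `resetModel` after reading a word. -/
noncomputable def resetRun (ℓ n : ℕ) (s : ℕ → Fin 2) (τ : ℕ → Bool)
    (x : Option (Bool × ℕ)) (w : List (Fin 2)) : Option (Bool × ℕ) :=
  w.foldl (resetStep ℓ n s τ) x

section Reset

variable {ℓ n : ℕ} {s : ℕ → Fin 2} {τ : ℕ → Bool}

theorem resetRun_cons (x : Option (Bool × ℕ)) (a : Fin 2) (w : List (Fin 2)) :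
    resetRun ℓ n s τ x (a :: w) = resetRun ℓ n s τ (resetStep ℓ n s τ x a) w := rfl

theorem resetRun_none (w : List (Fin 2)) : resetRun ℓ n s τ none w = none := by
  induction w with
  | nil => rfl
  | cons a w ih => exact ih

theorem sSucc_resetModel (w : List (Fin 2)) (x y : Option (Bool × ℕ)) :
    sSucc (resetModel ℓ n s τ) w x y ↔ y = resetRun ℓ n s τ x w := by
  induction w generalizing x with
  | nil => exact Iff.rfl
  | cons a w ih =>
    constructor
    · rintro ⟨u, hu, h⟩
      subst hu
      exact (ih _).1 h
    · intro h
      exact ⟨resetStep ℓ n s τ x a, rfl, (ih _).2 h⟩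

theorem satisfies_box_resetModel {Os : Set (SSF 2)} (O : Os) (L : Set (List (Fin 2)))
    (hO : O.val = OfLang L) (χ : MLFormula Os) (x : Option (Bool × ℕ)) :
    Satisfies (resetModel ℓ n s τ) x (.box O χ) ↔
      ∀ w ∈ L, Satisfies (resetModel ℓ n s τ) (resetRun ℓ n s τ x w) χ := by
  simp only [Satisfies, hO]
  constructor
  · intro h w hw
    exact h _ ⟨w, hw, (sSucc_resetModel w x _).2 rfl⟩
  · rintro h y ⟨w, hw, hy⟩
    rw [(sSucc_resetModel w x y).1 hy]
    exact h w hw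

/-- `w` is the segment starting at position `d` of the word of length `n` spelled by `s`. -/
def IsSegment (ℓ n : ℕ) (s : ℕ → Fin 2) : ℕ → List (Fin 2) → Prop
  | _, [] => True
  | d, a :: w => d < n ∧ bLetter ℓ s d = a ∧ IsSegment ℓ n s (d + 1) w

theorem IsSegment.resetRun_eq {d : ℕ} {w : List (Fin 2)} (h : IsSegment ℓ n s d w) (c : Bool) :
    resetRun ℓ n s τ (some (c, d)) w = some (c, d + w.length) := by
  induction w generalizing d with
  | nil => rfl
  | cons a w ih =>
    obtain ⟨h₁, h₂, h₃⟩ := h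
    rw [resetRun_cons, resetStep, if_neg (by omega), if_pos h₂, ih h₃, List.length_cons]
    congr 2
    omega

theorem resetRun_eq_or_isSegment (c c' : Bool) (d : ℕ) (w : List (Fin 2)) :
    resetRun ℓ n s τ (some (c, d)) w = resetRun ℓ n s τ (some (c', d)) w ∨
      IsSegment ℓ n s d w := by
  induction w generalizing d with
  | nil => exact Or.inr trivial
  | cons a w ih =>
    by_cases h₁ : n ≤ d
    · left
      simp only [resetRun_cons, resetStep, if_pos h₁]
    by_cases h₂ : bLetter ℓ s d = a
    · rcases ih (d + 1) with h | h
      · left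
        simpa only [resetRun_cons, resetStep, if_neg h₁, if_pos h₂] using h
      · exact Or.inr ⟨by omega, h₂, h⟩
    · left
      simp only [resetRun_cons, resetStep, if_neg h₁, if_neg h₂]

theorem IsSegment.bLetter_eq {d m : ℕ} {b : Fin 2} (h : IsSegment ℓ n s d (altWord b m))
    {e : ℕ} (he : e < m) : bLetter ℓ s (d + e) = altLetter b e := by
  induction m generalizing d b e with
  | zero => omega
  | succ m ih =>
    rw [altWord_succ] at h
    obtain ⟨-, h₂, h₃⟩ := h
    cases e with
    | zero => rw [altLetter_zero]; exact h₂
    | succ e =>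
      rw [altLetter_succ, ← ih h₃ (by omega)]
      congr 1
      omega

theorem isSegment_altWord_of {d m : ℕ} {b : Fin 2} (hd : d + m ≤ n)
    (h : ∀ e < m, bLetter ℓ s (d + e) = altLetter b e) : IsSegment ℓ n s d (altWord b m) := by
  induction m generalizing d b with
  | zero => trivial
  | succ m ih =>
    rw [altWord_succ]
    refine ⟨by omega, by simpa [altLetter_zero] using h 0 (by omega), ih (by omega) ?_⟩
    intro e he
    rw [← altLetter_succ, ← h (e + 1) (by omega)]
    congr 1
    omega

/-- Reading the complement of the correct alternating word inside of a block. -/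
theorem IsSegment.resetRun_compl {d m : ℕ} {b : Fin 2}
    (h : IsSegment ℓ n s d (altWord b (m + 1))) (hd : d % ℓ ≠ 0) (hm : d % ℓ + (m + 1) ≤ ℓ)
    (c : Bool) :
    resetRun ℓ n s τ (some (c, d)) (altWord (b + 1) (m + 1)) =
      some (τ (d / ℓ), d + (m + 1)) := by
  induction m generalizing d b c with
  | zero =>
    rw [altWord_succ] at h
    obtain ⟨h₁, h₂, -⟩ := h
    rw [altWord_succ, resetRun_cons, resetStep, if_neg (by omega),
      if_neg (by rw [h₂]; exact fin2_ne_add_one b), if_neg hd]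
    rfl
  | succ m ih =>
    rw [altWord_succ] at h
    obtain ⟨h₁, h₂, h₃⟩ := h
    have hlt : d % ℓ + 1 < ℓ := by omega
    have hdecomp : d + 1 = ℓ * (d / ℓ) + (d % ℓ + 1) := by
      have := Nat.div_add_mod d ℓ
      omega
    have hmod : (d + 1) % ℓ = d % ℓ + 1 := by
      rw [hdecomp, Nat.mul_add_mod, Nat.mod_eq_of_lt hlt]
    have hdiv : (d + 1) / ℓ = d / ℓ := by
      rw [hdecomp, Nat.mul_add_div (by omega), Nat.div_eq_of_lt hlt, Nat.add_zero]
    rw [altWord_succ, resetRun_cons, resetStep, if_neg (by omega),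
      if_neg (by rw [h₂]; exact fin2_ne_add_one b), if_neg hd,
      ih h₃ (by omega) (by omega), hdiv]
    congr 2
    omega

end Reset

/-! ### The formulas `[A_ℓ]^i p` on the separating models -/

/-- The formula `[O]^i p`. -/
def iterBox {n : ℕ} {Os : Set (SSF n)} (O : Os) : ℕ → MLFormula Os
  | 0 => .var 0
  | i + 1 => .box O (iterBox O i)

theorem size_iterBox {n : ℕ} {Os : Set (SSF n)} (O : Os) (i : ℕ) :
    (iterBox O i).size = i + 1 := by
  induction i with
  | zero => rfl
  | succ i ih => simp [iterBox, MLFormula.size, ih]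

theorem satisfies_iterBox_none {ℓ n : ℕ} {s : ℕ → Fin 2} {τ : ℕ → Bool} {Os : Set (SSF 2)}
    (O : Os) (L : Set (List (Fin 2))) (hO : O.val = OfLang L) (i : ℕ) :
    Satisfies (resetModel ℓ n s τ) none (iterBox O i) := by
  induction i with
  | zero => simp [iterBox, Satisfies, resetModel]
  | succ i ih =>
    rw [iterBox, satisfies_box_resetModel O L hO]
    intro w _
    rw [resetRun_none]
    exact ih

theorem isSegment_block {ℓ : ℕ} (s : ℕ → Fin 2) {i j : ℕ} (hj : j < i) :
    IsSegment ℓ (i * ℓ) s (j * ℓ) (altWord (s j) ℓ) := by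
  apply isSegment_altWord_of
  · calc j * ℓ + ℓ = (j + 1) * ℓ := by ring
      _ ≤ i * ℓ := Nat.mul_le_mul_right _ hj
  · intro e he
    exact bLetter_mul_add s j he

theorem resetRun_wrong_block {ℓ n : ℕ} (hℓ : 1 ≤ ℓ) (s : ℕ → Fin 2) (τ : ℕ → Bool) (j : ℕ)
    (c : Bool) : resetRun ℓ n s τ (some (c, j * ℓ)) (altWord (s j + 1) ℓ) = none := by
  obtain ⟨m, rfl⟩ : ∃ m, ℓ = m + 1 := ⟨ℓ - 1, by omega⟩
  rw [altWord_succ, resetRun_cons, resetStep, bLetter_mul (by omega),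
    if_neg (fin2_ne_add_one (s j)), if_pos (Nat.mul_mod_left _ _), ite_self, resetRun_none]

theorem satisfies_iterBox_iff {ℓ : ℕ} (hℓ : 1 ≤ ℓ) {Os : Set (SSF 2)} (O : Os)
    (hO : O.val = OfLang (altLang ℓ)) (s : ℕ → Fin 2) (τ : ℕ → Bool) (c : Bool) (i j k : ℕ)
    (hi : j + k = i) :
    Satisfies (resetModel ℓ (i * ℓ) s τ) (some (c, j * ℓ)) (iterBox O k) ↔ c = true := by
  induction k generalizing j with
  | zero =>
    obtain rfl : j = i := by omega
    cases c <;> simp [iterBox, Satisfies, resetModel]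
  | succ k ih =>
    have key : resetRun ℓ (i * ℓ) s τ (some (c, j * ℓ)) (altWord (s j) ℓ) =
        some (c, (j + 1) * ℓ) := by
      rw [(isSegment_block s (by omega)).resetRun_eq, length_altWord]
      congr 2
      ring
    rw [iterBox, satisfies_box_resetModel O _ hO, ← ih (j + 1) (by omega)]
    constructor
    · intro h
      rw [← key]
      exact h _ (mem_altLang.2 ⟨_, rfl⟩)
    · intro h w hw
      obtain ⟨b, rfl⟩ := mem_altLang.1 hw
      rcases fin2_eq_or b (s j) with rfl | rfl
      · rw [key]
        exact h
      · rw [resetRun_wrong_block hℓ]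
        exact satisfies_iterBox_none O _ hO k

/-! ### Box chains -/

/-- The language of a box operator: a single letter, or an alternation language. -/
def opLang : Fin 2 ⊕ ℕ → Set (List (Fin 2))
  | .inl b => {[b]}
  | .inr m => altLang m

/-- The common length of the words in `opLang`. -/
def opLen : Fin 2 ⊕ ℕ → ℕ
  | .inl _ => 1
  | .inr m => m

/-- Necessary condition for a box at depth `d` to preserve a distinction of polarity `pol`. -/
def BoxCond (ℓ : ℕ) (s : ℕ → Fin 2) (τ : ℕ → Bool) (pol : Bool) (d : ℕ) : Fin 2 ⊕ ℕ → Prop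
  | .inl b => bLetter ℓ s d = b
  | .inr m => (∀ e, e + 1 < m → bLetter ℓ s (d + e + 1) ≠ bLetter ℓ s (d + e)) ∧
      (1 ≤ m → d % ℓ ≠ 0 → d % ℓ + m ≤ ℓ → τ (d / ℓ) = pol)

/-- All boxes of a chain starting at depth `d` satisfy `BoxCond`, and the chain ends at
depth `n`. -/
def Survives (ℓ n : ℕ) (s : ℕ → Fin 2) (τ : ℕ → Bool) : List (Bool × (Fin 2 ⊕ ℕ)) → ℕ → Prop
  | [], d => d = n
  | (pol, op) :: c, d => BoxCond ℓ s τ pol d op ∧ Survives ℓ n s τ c (d + opLen op)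

/-- Total word length of a chain. -/
def chainLen (c : List (Bool × (Fin 2 ⊕ ℕ))) : ℕ := (c.map fun x => opLen x.2).sum

theorem chainLen_cons (x : Bool × (Fin 2 ⊕ ℕ)) (c : List (Bool × (Fin 2 ⊕ ℕ))) :
    chainLen (x :: c) = opLen x.2 + chainLen c := by
  simp [chainLen]

theorem length_of_mem_opLang {op : Fin 2 ⊕ ℕ} {w : List (Fin 2)} (h : w ∈ opLang op) :
    w.length = opLen op := by
  rcases op with b | m
  · rw [show w = [b] from h]; rfl
  · obtain ⟨b, rfl⟩ := mem_altLang.1 h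
    exact length_altWord b m

theorem box_separation {ℓ n : ℕ} {s : ℕ → Fin 2} {τ : ℕ → Bool} {Os : Set (SSF 2)}
    (O : Os) (op : Fin 2 ⊕ ℕ) (hO : O.val = OfLang (opLang op)) (χ : MLFormula Os)
    (pol : Bool) (d : ℕ)
    (h₁ : Satisfies (resetModel ℓ n s τ) (some (pol, d)) (.box O χ))
    (h₂ : ¬ Satisfies (resetModel ℓ n s τ) (some (!pol, d)) (.box O χ)) :
    BoxCond ℓ s τ pol d op ∧
      Satisfies (resetModel ℓ n s τ) (some (pol, d + opLen op)) χ ∧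
      ¬ Satisfies (resetModel ℓ n s τ) (some (!pol, d + opLen op)) χ := by
  rw [satisfies_box_resetModel O _ hO] at h₁ h₂
  push Not at h₂
  obtain ⟨w, hw, hχ⟩ := h₂
  rcases resetRun_eq_or_isSegment (ℓ := ℓ) (n := n) (s := s) (τ := τ) pol (!pol) d w with h | hseg
  · exact absurd (h ▸ h₁ w hw) hχ
  have hχ' := h₁ w hw
  rw [hseg.resetRun_eq, length_of_mem_opLang hw] at hχ hχ'
  refine ⟨?_, hχ', hχ⟩
  rcases op with b | m
  · obtain rfl : w = [b] := hw
    exact hseg.2.1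
  · obtain ⟨b, rfl⟩ := mem_altLang.1 hw
    refine ⟨fun e he => ?_, fun hm hd hdm => ?_⟩
    · rw [hseg.bLetter_eq (by omega), Nat.add_assoc, hseg.bLetter_eq he, altLetter_succ']
      exact (fin2_ne_add_one _).symm
    · obtain ⟨m, rfl⟩ : ∃ m', m = m' + 1 := ⟨m - 1, by omega⟩
      have hX := h₁ (altWord (b + 1) (m + 1)) (mem_altLang.2 ⟨_, rfl⟩)
      rw [hseg.resetRun_compl hd hdm] at hX
      by_contra hne
      have hτ : τ (d / ℓ) = !pol := by
        revert hne
        cases τ (d / ℓ) <;> cases pol <;> simp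
      rw [hτ] at hX
      exact hχ hX

theorem exists_op {I : Set ℕ} {O : SSF 2} (hO : O ∈ MLAp_ops I) :
    ∃ op : Fin 2 ⊕ ℕ, O = OfLang (opLang op) ∧ ∀ m, op = .inr m → m ∈ I := by
  rcases hO with ⟨m, hm, rfl⟩ | rfl | rfl
  · exact ⟨.inr m, rfl, fun m' h => by cases h; exact hm⟩
  · exact ⟨.inl 0, rfl, fun m' h => by cases h⟩
  · exact ⟨.inl 1, rfl, fun m' h => by cases h⟩

/-- A formula has at most `size` many box chains, one of which survives whenever the formula
distinguishes the two worlds of depth `d` of a separating model. -/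
theorem exists_chains {I : Set ℕ} (ℓ n : ℕ) (ψ : MLFormula (MLAp_ops I)) (pol : Bool) :
    ∃ S : Finset (List (Bool × (Fin 2 ⊕ ℕ))), S.card ≤ ψ.size ∧
      (∀ c ∈ S, ∀ x ∈ c, ∀ m, x.2 = Sum.inr m → m ∈ I) ∧
      ∀ (s : ℕ → Fin 2) (τ : ℕ → Bool) (d : ℕ),
        Satisfies (resetModel ℓ n s τ) (some (pol, d)) ψ →
        ¬ Satisfies (resetModel ℓ n s τ) (some (!pol, d)) ψ →
        ∃ c ∈ S, Survives ℓ n s τ c d := by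
  induction ψ generalizing pol with
  | var p =>
    refine ⟨{[]}, by simp [MLFormula.size], by simp, fun s τ d _ h₂ => ⟨[], by simp, ?_⟩⟩
    have h₃ : (some (!pol, d) : Option (Bool × ℕ)) = some (false, n) := not_not.1 h₂
    exact congrArg Prod.snd (Option.some.inj h₃)
  | neg ψ ih =>
    obtain ⟨S, hS, hI, h⟩ := ih (!pol)
    refine ⟨S, by simp only [MLFormula.size]; omega, hI, fun s τ d h₁ h₂ => h s τ d ?_ ?_⟩
    · simpa only [Satisfies, not_not] using h₂
    · simpa only [Satisfies, Bool.not_not] using h₁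
  | or ψ₁ ψ₂ ih₁ ih₂ =>
    obtain ⟨S₁, hS₁, hI₁, h₁⟩ := ih₁ pol
    obtain ⟨S₂, hS₂, hI₂, h₂⟩ := ih₂ pol
    refine ⟨S₁ ∪ S₂, ?_, ?_, ?_⟩
    · have := Finset.card_union_le S₁ S₂
      simp only [MLFormula.size]
      omega
    · intro c hc
      rcases Finset.mem_union.1 hc with hc | hc
      exacts [hI₁ c hc, hI₂ c hc]
    · intro s τ d hp hn
      simp only [Satisfies, not_or] at hp hn
      rcases hp with hp | hp
      · obtain ⟨c, hc, hs⟩ := h₁ s τ d hp hn.1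
        exact ⟨c, Finset.mem_union_left _ hc, hs⟩
      · obtain ⟨c, hc, hs⟩ := h₂ s τ d hp hn.2
        exact ⟨c, Finset.mem_union_right _ hc, hs⟩
  | box O χ ih =>
    obtain ⟨S, hS, hI, h⟩ := ih pol
    obtain ⟨op, hop, hopI⟩ := exists_op O.2
    refine ⟨S.image fun c => (pol, op) :: c, ?_, ?_, ?_⟩
    · have := Finset.card_image_le (s := S) (f := fun c => (pol, op) :: c)
      simp only [MLFormula.size]
      omega
    · intro c' hc' x hx
      obtain ⟨c, hc, rfl⟩ := Finset.mem_image.1 hc'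
      rcases List.mem_cons.1 hx with rfl | hx
      exacts [hopI, hI c hc x hx]
    · intro s τ d hp hn
      obtain ⟨hcond, hp', hn'⟩ := box_separation O op hop χ pol d hp hn
      obtain ⟨c, hc, hs⟩ := h s τ _ hp' hn'
      exact ⟨(pol, op) :: c, Finset.mem_image_of_mem _ hc, hcond, hs⟩

theorem Survives.chainLen_eq {ℓ n : ℕ} {s : ℕ → Fin 2} {τ : ℕ → Bool}
    {c : List (Bool × (Fin 2 ⊕ ℕ))} {d : ℕ} (h : Survives ℓ n s τ c d) :
    d + chainLen c = n := by
  induction c generalizing d with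
  | nil => exact h
  | cons x c ih =>
    have := ih h.2
    rw [chainLen_cons]
    omega

theorem Survives.of_append {ℓ n : ℕ} {s : ℕ → Fin 2} {τ : ℕ → Bool}
    {c₁ c₂ : List (Bool × (Fin 2 ⊕ ℕ))} {d : ℕ} (h : Survives ℓ n s τ (c₁ ++ c₂) d) :
    Survives ℓ n s τ c₂ (d + chainLen c₁) := by
  induction c₁ generalizing d with
  | nil => simpa [chainLen] using h
  | cons x c ih =>
    rw [chainLen_cons, ← Nat.add_assoc]
    exact ih h.2

theorem exists_covering_box (c : List (Bool × (Fin 2 ⊕ ℕ))) (x : ℕ) (hx : x < chainLen c) :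
    ∃ c₁ b c₂, c = c₁ ++ b :: c₂ ∧ chainLen c₁ ≤ x ∧ x < chainLen c₁ + opLen b.2 := by
  induction c generalizing x with
  | nil => simp [chainLen] at hx
  | cons b c ih =>
    by_cases h : x < opLen b.2
    · exact ⟨[], b, c, rfl, by simp [chainLen], by simpa [chainLen] using h⟩
    · rw [chainLen_cons] at hx
      obtain ⟨c₁, b', c₂, rfl, h₁, h₂⟩ := ih (x - opLen b.2) (by omega)
      exact ⟨b :: c₁, b', c₂, rfl, by rw [chainLen_cons]; omega, by rw [chainLen_cons]; omega⟩

/-! ### Counting -/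

/-- The branch string encoded by a parameter: two letters per entry. -/
noncomputable def branchOf {k : ℕ} (f : Fin k → Fin 2 × Fin 2 × Bool) (j : ℕ) : Fin 2 :=
  if h : j / 2 < k then
    if j % 2 = 0 then (f ⟨j / 2, h⟩).1 else (f ⟨j / 2, h⟩).2.1
  else 0

/-- The reset values encoded by a parameter: one value for each pair of blocks. -/
noncomputable def resetOf {k : ℕ} (f : Fin k → Fin 2 × Fin 2 × Bool) (j : ℕ) : Bool :=
  if h : j / 2 < k then (f ⟨j / 2, h⟩).2.2 else false

section Branch

variable {k : ℕ} (f : Fin k → Fin 2 × Fin 2 × Bool) (q : Fin k)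

theorem branchOf_even : branchOf f (2 * q) = (f q).1 := by
  simp [branchOf]

theorem branchOf_odd : branchOf f (2 * q + 1) = (f q).2.1 := by
  have h₁ : (2 * (q : ℕ) + 1) / 2 = q := by omega
  have h₂ : (2 * (q : ℕ) + 1) % 2 = 1 := by omega
  simp [branchOf, h₁, h₂]

theorem resetOf_even : resetOf f (2 * q) = (f q).2.2 := by
  simp [resetOf]

theorem branchOf_congr {f g : Fin k → Fin 2 × Fin 2 × Bool} {q : Fin k}
    (h : ∀ q' < q, f q' = g q') {j : ℕ} (hj : j < 2 * q) : branchOf f j = branchOf g j := by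
  have hj' : j / 2 < k := by omega
  have := h ⟨j / 2, hj'⟩ (by rw [Fin.lt_def]; simp only; omega)
  simp only [branchOf, dif_pos hj', this]

end Branch

/-- Given the entries before `q`, all but one bit of the entry `q` of a parameter for which the
chain `c` survives determine this entry. -/
def DeterminesBit (ℓ k : ℕ) (c : List (Bool × (Fin 2 ⊕ ℕ))) (q : Fin k) : Prop :=
  ∃ r : Fin 2 × Fin 2 × Bool → Fin 2 × Bool, ∀ f g : Fin k → Fin 2 × Fin 2 × Bool,
    Survives ℓ (2 * k * ℓ) (branchOf f) (resetOf f) c 0 →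
    Survives ℓ (2 * k * ℓ) (branchOf g) (resetOf g) c 0 →
    (∀ q' < q, f q' = g q') → r (f q) = r (g q) → f q = g q

/-- For each pair of blocks, a fixed chain determines one bit of the parameters it survives
for, given the previous parameters. -/
theorem determinesBit {I : Set ℕ} {ℓ k : ℕ} (hℓ : 1 ≤ ℓ) (hI : ∀ m ∈ I, 1 ≤ m)
    (hℓI : ℓ ∉ I) (c : List (Bool × (Fin 2 ⊕ ℕ)))
    (hc : ∀ x ∈ c, ∀ m, x.2 = Sum.inr m → m ∈ I) (q : Fin k) :
    DeterminesBit ℓ k c q := by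
  by_cases hlen : chainLen c = 2 * k * ℓ
  swap
  · refine ⟨fun _ => (0, false), fun f g hf => absurd ?_ hlen⟩
    simpa using hf.chainLen_eq
  have hqk : (2 * (q : ℕ) + 2) * ℓ ≤ 2 * k * ℓ := Nat.mul_le_mul_right _ (by omega)
  have hq2 : (2 * (q : ℕ) + 2) * ℓ = 2 * q * ℓ + ℓ + ℓ := by ring
  have hq1 : (2 * (q : ℕ) + 1) * ℓ = 2 * q * ℓ + ℓ := by ring
  have fix_fst : (∀ f g : Fin k → Fin 2 × Fin 2 × Bool,
      Survives ℓ (2 * k * ℓ) (branchOf f) (resetOf f) c 0 →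
      Survives ℓ (2 * k * ℓ) (branchOf g) (resetOf g) c 0 →
      (∀ q' < q, f q' = g q') → branchOf f (2 * q) = branchOf g (2 * q)) →
      DeterminesBit ℓ k c q := by
    intro H
    refine ⟨fun p => p.2, fun f g hf hg hfg hr => Prod.ext ?_ hr⟩
    simpa only [branchOf_even] using H f g hf hg hfg
  have fix_reset : (∃ b : Bool, ∀ f : Fin k → Fin 2 × Fin 2 × Bool,
      Survives ℓ (2 * k * ℓ) (branchOf f) (resetOf f) c 0 → resetOf f (2 * q) = b) →
      DeterminesBit ℓ k c q := by
    rintro ⟨b, H⟩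
    refine ⟨fun p => (p.1, decide (p.2.1 = 0)), fun f g hf hg _ hr => ?_⟩
    have h₁ := (H f hf).trans (H g hg).symm
    rw [resetOf_even, resetOf_even] at h₁
    simp only [Prod.mk.injEq, decide_eq_decide] at hr
    refine Prod.ext hr.1 (Prod.ext ?_ h₁)
    by_cases h0 : (f q).2.1 = 0
    · rw [h0, hr.2.1 h0]
    · exact fin2_eq_of_ne h0 fun h => h0 (hr.2.2 h)
  have fix_snd : (∀ f : Fin k → Fin 2 × Fin 2 × Bool,
      Survives ℓ (2 * k * ℓ) (branchOf f) (resetOf f) c 0 →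
      bLetter ℓ (branchOf f) (2 * q * ℓ + (ℓ - 1) + 1) ≠
        bLetter ℓ (branchOf f) (2 * q * ℓ + (ℓ - 1))) →
      DeterminesBit ℓ k c q := by
    intro H
    refine ⟨fun p => (p.1, p.2.2), fun f g hf hg _ hr => ?_⟩
    have H' : ∀ f, Survives ℓ (2 * k * ℓ) (branchOf f) (resetOf f) c 0 →
        (f q).2.1 ≠ altLetter (f q).1 (ℓ - 1) := by
      intro f hf
      have := H f hf
      rwa [bLetter_mul_add _ _ (by omega), branchOf_even,
        show 2 * (q : ℕ) * ℓ + (ℓ - 1) + 1 = (2 * q + 1) * ℓ by omega, bLetter_mul hℓ,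
        branchOf_odd] at this
    simp only [Prod.mk.injEq] at hr
    refine Prod.ext hr.1 (Prod.ext ?_ hr.2)
    have h₁ := H' f hf
    rw [hr.1] at h₁
    exact fin2_eq_of_ne h₁ (H' g hg)
  obtain ⟨c₁, ⟨pol, op⟩, c₂, rfl, h₁, h₂⟩ :=
    exists_covering_box c (2 * q * ℓ) (by omega)
  have hcond : ∀ f : Fin k → Fin 2 × Fin 2 × Bool,
      Survives ℓ (2 * k * ℓ) (branchOf f) (resetOf f) (c₁ ++ (pol, op) :: c₂) 0 →
      BoxCond ℓ (branchOf f) (resetOf f) pol (chainLen c₁) op ∧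
        Survives ℓ (2 * k * ℓ) (branchOf f) (resetOf f) c₂ (chainLen c₁ + opLen op) := by
    intro f hf
    have := hf.of_append
    rwa [Nat.zero_add] at this
  rcases op with b | m
  · -- a single letter box at the block boundary
    have he : chainLen c₁ = 2 * q * ℓ := by
      simp only [opLen] at h₂
      omega
    apply fix_fst
    intro f g hf hg _
    have hf' : bLetter ℓ (branchOf f) (chainLen c₁) = b := (hcond f hf).1
    have hg' : bLetter ℓ (branchOf g) (chainLen c₁) = b := (hcond g hg).1
    rw [he, bLetter_mul hℓ] at hf' hg'
    rw [hf', hg']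
  simp only [opLen] at h₂
  have hmI : m ∈ I := hc (pol, Sum.inr m) (by simp) m rfl
  have hmℓ : m ≠ ℓ := fun h => hℓI (h ▸ hmI)
  have hm1 := hI m hmI
  rcases Nat.lt_or_ge (chainLen c₁) (2 * q * ℓ) with hlt | hge
  · -- an alternation box crossing the block boundary
    apply fix_fst
    intro f g hf hg hfg
    have key : ∀ f : Fin k → Fin 2 × Fin 2 × Bool,
        Survives ℓ (2 * k * ℓ) (branchOf f) (resetOf f) (c₁ ++ (pol, .inr m) :: c₂) 0 →
        branchOf f (2 * q) ≠ bLetter ℓ (branchOf f) (2 * q * ℓ - 1) := by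
      intro f hf
      have := (hcond f hf).1.1 (2 * q * ℓ - 1 - chainLen c₁) (by omega)
      rwa [show chainLen c₁ + (2 * q * ℓ - 1 - chainLen c₁) + 1 = 2 * q * ℓ by omega,
        show chainLen c₁ + (2 * q * ℓ - 1 - chainLen c₁) = 2 * q * ℓ - 1 by omega,
        bLetter_mul hℓ] at this
    have hprev : bLetter ℓ (branchOf f) (2 * q * ℓ - 1) =
        bLetter ℓ (branchOf g) (2 * q * ℓ - 1) := by
      unfold bLetter
      rw [branchOf_congr hfg]
      rw [Nat.div_lt_iff_lt_mul hℓ]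
      omega
    have h₃ := key f hf
    rw [hprev] at h₃
    exact fin2_eq_of_ne h₃ (key g hg)
  have he : chainLen c₁ = 2 * q * ℓ := by omega
  rcases Nat.lt_or_ge ℓ m with hgt | hle
  · -- an alternation box covering the next block boundary
    apply fix_snd
    intro f hf
    have := (hcond f hf).1.1 (ℓ - 1) (by omega)
    rwa [he] at this
  -- an alternation box ending inside of the block
  have hlen₂ : ∀ f : Fin k → Fin 2 × Fin 2 × Bool,
      Survives ℓ (2 * k * ℓ) (branchOf f) (resetOf f) (c₁ ++ (pol, .inr m) :: c₂) 0 →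
      Survives ℓ (2 * k * ℓ) (branchOf f) (resetOf f) c₂ (2 * q * ℓ + m) := by
    intro f hf
    have := (hcond f hf).2
    rwa [he] at this
  rcases c₂ with _ | ⟨⟨pol', op'⟩, c₃⟩
  · refine ⟨fun _ => (0, false), fun f g hf => ?_⟩
    have h₃ : 2 * q * ℓ + m = 2 * k * ℓ := hlen₂ f hf
    omega
  have hcond' : ∀ f : Fin k → Fin 2 × Fin 2 × Bool,
      Survives ℓ (2 * k * ℓ) (branchOf f) (resetOf f)
        (c₁ ++ (pol, .inr m) :: (pol', op') :: c₃) 0 →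
      BoxCond ℓ (branchOf f) (resetOf f) pol' (2 * q * ℓ + m) op' :=
    fun f hf => (hlen₂ f hf).1
  rcases op' with b | m'
  · apply fix_fst
    intro f g hf hg _
    have hf' : bLetter ℓ (branchOf f) (2 * q * ℓ + m) = b := hcond' f hf
    have hg' : bLetter ℓ (branchOf g) (2 * q * ℓ + m) = b := hcond' g hg
    rw [bLetter_mul_add _ _ (by omega)] at hf' hg'
    have h₃ := hf'.trans hg'.symm
    unfold altLetter at h₃
    split_ifs at h₃
    · exact h₃
    · exact add_right_cancel h₃
  have hm'1 := hI m' (hc (pol', Sum.inr m') (by simp) m' rfl)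
  have hmod : (2 * (q : ℕ) * ℓ + m) % ℓ = m := Nat.mul_add_mod_of_lt (by omega)
  have hdiv : (2 * (q : ℕ) * ℓ + m) / ℓ = 2 * q := by
    rw [Nat.mul_comm, Nat.mul_add_div (by omega), Nat.div_eq_of_lt (by omega), Nat.add_zero]
  by_cases hin : m + m' ≤ ℓ
  · apply fix_reset
    refine ⟨pol', fun f hf => ?_⟩
    have := (hcond' f hf).2 hm'1
    rw [hmod, hdiv] at this
    exact this (by omega) hin
  · apply fix_snd
    intro f hf
    have := (hcond' f hf).1 (ℓ - 1 - m) (by omega)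
    rwa [show 2 * (q : ℕ) * ℓ + m + (ℓ - 1 - m) = 2 * q * ℓ + (ℓ - 1) by omega] at this

/-- A set of sequences in which every entry is determined by the previous entries and by one
of finitely many labels of that entry has at most as many elements as there are sequences of
labels. -/
theorem card_le_of_determination {k : ℕ} {α β : Type*} [Fintype β] (F : Finset (Fin k → α))
    (r : Fin k → α → β)
    (h : ∀ q, ∀ f ∈ F, ∀ g ∈ F, (∀ q' < q, f q' = g q') → r q (f q) = r q (g q) → f q = g q) :
    F.card ≤ Fintype.card β ^ k := by
  have hcard : Fintype.card (Fin k → β) = Fintype.card β ^ k := by simp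
  rw [← hcard, ← Finset.card_univ]
  refine Finset.card_le_card_of_injOn (fun f q => r q (f q)) (fun _ _ => Finset.mem_univ _) ?_
  intro f hf g hg hfg
  funext q
  induction q using WellFoundedLT.induction with
  | ind q ih => exact h q f hf g hg ih (congrFun hfg q)

theorem two_pow_le_size {I : Set ℕ} {ℓ k : ℕ} (hℓ : 1 ≤ ℓ) (hI : ∀ m ∈ I, 1 ≤ m)
    (hℓI : ℓ ∉ I) (ψ : MLFormula (MLAp_ops I))
    (hψ : ∀ s τ, Satisfies (resetModel ℓ (2 * k * ℓ) s τ) (some (true, 0)) ψ ∧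
      ¬ Satisfies (resetModel ℓ (2 * k * ℓ) s τ) (some (false, 0)) ψ) :
    2 ^ k ≤ ψ.size := by
  obtain ⟨S, hS, hSI, h⟩ := exists_chains ℓ (2 * k * ℓ) ψ true
  let F : List (Bool × (Fin 2 ⊕ ℕ)) → Finset (Fin k → Fin 2 × Fin 2 × Bool) := fun c =>
    Finset.univ.filter fun f => Survives ℓ (2 * k * ℓ) (branchOf f) (resetOf f) c 0
  have hF : ∀ c ∈ S, (F c).card ≤ 4 ^ k := by
    intro c hc
    choose r hr using determinesBit (k := k) hℓ hI hℓI c (hSI c hc)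
    have := card_le_of_determination (F c) r fun q f hf g hg =>
      hr q f g (Finset.mem_filter.1 hf).2 (Finset.mem_filter.1 hg).2
    simpa using this
  have hcover : (Finset.univ : Finset (Fin k → Fin 2 × Fin 2 × Bool)) ⊆ S.biUnion F := by
    intro f _
    obtain ⟨c, hc, hs⟩ := h (branchOf f) (resetOf f) 0 (hψ _ _).1 (hψ _ _).2
    exact Finset.mem_biUnion.2 ⟨c, hc, Finset.mem_filter.2 ⟨Finset.mem_univ _, hs⟩⟩
  have h₁ := (Finset.card_le_card hcover).trans (Finset.card_biUnion_le_card_mul S F _ hF)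
  have h₂ : (Finset.univ : Finset (Fin k → Fin 2 × Fin 2 × Bool)).card = 2 ^ k * 4 ^ k := by
    rw [← mul_pow]
    simp
  rw [h₂] at h₁
  exact (Nat.le_of_mul_le_mul_right h₁ (by positivity)).trans hS

theorem expMoreSuccinct_MLAp {I₁ I₂ : Set ℕ} (hI₂ : ∀ m ∈ I₂, 1 ≤ m) {ℓ : ℕ} (hℓ : 1 ≤ ℓ)
    (h₁ : ℓ ∈ I₁) (h₂ : ℓ ∉ I₂) : ExpMoreSuccinct (MLAp_ops I₁) (MLAp_ops I₂) := by
  let O : MLAp_ops I₁ := ⟨OfLang (altLang ℓ), Or.inl ⟨ℓ, h₁, rfl⟩⟩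
  refine ⟨fun k => iterBox O (2 * k), 2, 1, 2, by norm_num, fun k => ?_, fun k ψ hψ => ?_⟩
  · exact (size_iterBox O (2 * k)).le
  · have key : 2 ^ k ≤ ψ.size := by
      apply two_pow_le_size hℓ hI₂ h₂
      intro s τ
      have hsat := fun c => satisfies_iterBox_iff hℓ O rfl s τ c (2 * k) 0 (2 * k) (by omega)
      simp only [Nat.zero_mul] at hsat
      constructor
      · exact (hψ _ _).1 ((hsat true).2 rfl)
      · exact fun h => Bool.false_ne_true ((hsat false).1 ((hψ _ _).2 h))
    exact_mod_cast key

/-! ### Inexpressibility -/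

/-- Two paths spelling the word `a_ℓ^1`, connected by edges for all wrong letters except at
the beginning; every variable is false exactly at the end of the path marked `false`. -/
def crossModel (ℓ : ℕ) : KripkeModel 2 where
  W := Bool × ℕ
  nonempty := ⟨(true, 0)⟩
  R := fun j x y => y.2 = x.2 + 1 ∧ x.2 < ℓ ∧
    ((altLetter 0 x.2 = j ∧ y.1 = x.1) ∨ (altLetter 0 x.2 ≠ j ∧ 0 < x.2))
  val := fun _ => {x | x ≠ (false, ℓ)}

theorem sSucc_crossModel_depth {ℓ : ℕ} {w : List (Fin 2)} {x y : Bool × ℕ}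
    (hx : x.2 ≤ ℓ) (h : sSucc (crossModel ℓ) w x y) : y.2 = x.2 + w.length ∧ y.2 ≤ ℓ := by
  induction w generalizing x with
  | nil =>
    obtain rfl : y = x := h
    exact ⟨rfl, hx⟩
  | cons a w ih =>
    obtain ⟨u, ⟨hu, hu', -⟩, h⟩ := h
    obtain ⟨h₁, h₂⟩ := ih (x := u) (by omega) h
    rw [List.length_cons]
    omega

theorem sSucc_crossModel_correct {ℓ m d : ℕ} (b : Bool) (h : d + m ≤ ℓ) :
    sSucc (crossModel ℓ) (altWord (altLetter 0 d) m) (b, d) (b, d + m) := by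
  induction m generalizing d with
  | zero => rfl
  | succ m ih =>
    rw [altWord_succ, ← altLetter_succ']
    refine ⟨(b, d + 1), ⟨rfl, by simp only; omega, Or.inl ⟨rfl, rfl⟩⟩, ?_⟩
    have := ih (d := d + 1) (by omega)
    rwa [show d + 1 + m = d + (m + 1) by omega] at this

theorem sSucc_crossModel_compl {ℓ m d : ℕ} (b b' : Bool) (hd : 0 < d) (h : d + (m + 1) ≤ ℓ) :
    sSucc (crossModel ℓ) (altWord (altLetter 0 d + 1) (m + 1)) (b, d) (b', d + (m + 1)) := by
  induction m generalizing d b with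
  | zero =>
    rw [altWord_succ]
    exact ⟨(b', d + 1), ⟨rfl, by simp only; omega, Or.inr ⟨fin2_ne_add_one _, hd⟩⟩, rfl⟩
  | succ m ih =>
    rw [altWord_succ]
    refine ⟨(b', d + 1), ⟨rfl, by simp only; omega, Or.inr ⟨fin2_ne_add_one _, hd⟩⟩, ?_⟩
    have := ih b' (d := d + 1) (by omega) (by omega)
    rwa [show d + 1 + (m + 1) = d + (m + 1 + 1) by omega, altLetter_succ'] at this

theorem crossModel_forth {ℓ m d : ℕ} (hm : 1 ≤ m) (hmℓ : m ≠ ℓ) (hd : d < ℓ) (b b' : Bool)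
    {x' : Bool × ℕ} (hx' : x' ∈ OfLang (altLang m) (crossModel ℓ) (b, d)) :
    ∃ y' ∈ OfLang (altLang m) (crossModel ℓ) (b', d),
      x' = y' ∨ ((x' : Bool × ℕ).2 = (y' : Bool × ℕ).2 ∧ (x' : Bool × ℕ).2 < ℓ) := by
  obtain ⟨w, hw, hs⟩ := hx'
  obtain ⟨a, rfl⟩ := mem_altLang.1 hw
  obtain ⟨h₁, h₂⟩ := sSucc_crossModel_depth (le_of_lt hd) hs
  rw [length_altWord] at h₁
  simp only at h₁
  rcases Nat.lt_or_ge (d + m) ℓ with hlt | hge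
  · exact ⟨(b', d + m), ⟨_, mem_altLang.2 ⟨_, rfl⟩, sSucc_crossModel_correct b' (by omega)⟩,
      Or.inr ⟨h₁, by omega⟩⟩
  · refine ⟨x', ⟨altWord (altLetter 0 d + 1) m, mem_altLang.2 ⟨_, rfl⟩, ?_⟩, Or.inl rfl⟩
    obtain ⟨m, rfl⟩ : ∃ m', m = m' + 1 := ⟨m - 1, by omega⟩
    have := sSucc_crossModel_compl (ℓ := ℓ) (m := m) (d := d) b' x'.1 (by omega) (by omega)
    rwa [← h₁] at this

theorem satisfies_crossModel_iff {I : Set ℕ} {ℓ : ℕ} (hI : ∀ m ∈ I, 1 ≤ m) (hℓI : ℓ ∉ I)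
    (ψ : MLFormula (MLA_ops I)) (b b' : Bool) {d : ℕ} (hd : d < ℓ) :
    Satisfies (crossModel ℓ) (b, d) ψ ↔ Satisfies (crossModel ℓ) (b', d) ψ := by
  induction ψ generalizing b b' d with
  | var p =>
    have h : ∀ c : Bool, Satisfies (Os := MLA_ops I) (crossModel ℓ) (c, d) (.var p) := by
      intro c hc
      have := congrArg Prod.snd hc
      simp only at this
      omega
    exact ⟨fun _ => h b', fun _ => h b⟩
  | neg ψ ih => exact not_congr (ih b b' hd)
  | or ψ₁ ψ₂ ih₁ ih₂ => exact or_congr (ih₁ b b' hd) (ih₂ b b' hd)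
  | box O χ ih =>
    obtain ⟨_, m, hm, rfl⟩ := O
    have key : ∀ b b' : Bool,
        (∀ x' ∈ OfLang (altLang m) (crossModel ℓ) (b', d), Satisfies (crossModel ℓ) x' χ) →
        ∀ x' ∈ OfLang (altLang m) (crossModel ℓ) (b, d), Satisfies (crossModel ℓ) x' χ := by
      intro b b' h x' hx'
      obtain ⟨y', hy', hxy⟩ := crossModel_forth (hI m hm) (fun h => hℓI (h ▸ hm :)) hd b b' hx'
      rcases hxy with rfl | ⟨h₁, h₂⟩
      · exact h _ hy'
      · obtain ⟨x₁, x₂⟩ := x'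
        obtain ⟨y₁, y₂⟩ := y'
        obtain rfl : x₂ = y₂ := h₁
        exact (ih y₁ x₁ h₂).1 (h _ hy')
    exact ⟨key b' b, key b b'⟩

theorem sSucc_crossModel_root {ℓ m : ℕ} {a : Fin 2} {b : Bool} {d : ℕ} {y : Bool × ℕ}
    (ha : a = altLetter 0 d) (h : sSucc (crossModel ℓ) (altWord a m) (b, d) y) : y.1 = b := by
  induction m generalizing a b d with
  | zero =>
    obtain rfl : y = (b, d) := h
    rfl
  | succ m ih =>
    rw [altWord_succ] at h
    obtain ⟨⟨u₁, u₂⟩, ⟨hu, -, hu'⟩, h⟩ := h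
    simp only at hu hu'
    rcases hu' with ⟨-, rfl⟩ | ⟨hne, -⟩
    · exact ih (by rw [hu, altLetter_succ', ha]) h
    · exact absurd ha.symm hne

theorem exists_not_fEquiv_MLA {I₁ I₂ : Set ℕ} (hI₂ : ∀ m ∈ I₂, 1 ≤ m) {ℓ : ℕ} (hℓ : 1 ≤ ℓ)
    (h₁ : ℓ ∈ I₁) (h₂ : ℓ ∉ I₂) :
    ∃ φ : MLFormula (MLA_ops I₁), ∀ ψ : MLFormula (MLA_ops I₂), ¬ FEquiv φ ψ := by
  refine ⟨.box ⟨OfLang (altLang ℓ), ⟨ℓ, h₁, rfl⟩⟩ (.var 0), fun ψ hψ => ?_⟩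
  have hiff := ((hψ (crossModel ℓ) (true, 0)).trans
    (satisfies_crossModel_iff hI₂ h₂ ψ true false hℓ)).trans (hψ (crossModel ℓ) (false, 0)).symm
  have htrue : Satisfies (Os := MLA_ops I₁) (crossModel ℓ) (true, 0)
      (.box ⟨OfLang (altLang ℓ), ⟨ℓ, h₁, rfl⟩⟩ (.var 0)) := by
    rintro ⟨y₁, y₂⟩ ⟨w, hw, hs⟩ hy
    obtain ⟨a, rfl⟩ := mem_altLang.1 hw
    by_cases ha : a = altLetter 0 0
    · have h₃ := sSucc_crossModel_root ha hs
      have h₄ : y₁ = false := congrArg Prod.fst hy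
      simp only [h₄, Bool.false_eq_true] at h₃
    · obtain ⟨m, rfl⟩ : ∃ m, ℓ = m + 1 := ⟨ℓ - 1, by omega⟩
      rw [altWord_succ] at hs
      obtain ⟨u, ⟨-, -, hu | hu⟩, -⟩ := hs
      · exact ha hu.1.symm
      · exact absurd hu.2 (lt_irrefl 0)
  have hfalse := hiff.1 htrue (false, ℓ)
    ⟨_, mem_altLang.2 ⟨_, rfl⟩, by
      have := sSucc_crossModel_correct (ℓ := ℓ) (m := ℓ) (d := 0) false (by omega)
      rwa [Nat.zero_add] at this⟩
  exact hfalse rfl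

/-- if `I₁ ⊄ I₂` (sets of positive lengths), then (1) `ML_A⁺(I₁)` is
exponentially more succinct than `ML_A⁺(I₂)`, and (2) there is an `ML_A(I₁)`-formula with
no equivalent `ML_A(I₂)`-formula. -/
theorem statement6 (I₁ I₂ : Set ℕ) (hpos : ∀ m ∈ I₁ ∪ I₂, 1 ≤ m) (h : ¬ I₁ ⊆ I₂) :
    ExpMoreSuccinct (MLAp_ops I₁) (MLAp_ops I₂) ∧
    ∃ φ : MLFormula (MLA_ops I₁), ∀ ψ : MLFormula (MLA_ops I₂), ¬ FEquiv φ ψ := by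
  obtain ⟨ℓ, h₁, h₂⟩ := Set.not_subset.1 h
  have hℓ := hpos ℓ (Or.inl h₁)
  have hI₂ : ∀ m ∈ I₂, 1 ≤ m := fun m hm => hpos m (Or.inr hm)
  exact ⟨expMoreSuccinct_MLAp hI₂ hℓ h₁ h₂, exists_not_fEquiv_MLA hI₂ hℓ h₁ h₂⟩
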